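/- arXiv:math/0009113 — 4 statements merged into one kernel-verified Lean document; each statement's English description precedes it below -/
import Mathlib

section
/- Let v = (a,b,c,d)ᵀ be an integer root quadruple with a < 0 (so a < 0 ≤ b ≤ c ≤ d, a+b+c+d > 0, a+b+c ≥ d). Then there exist positive constants c₀ = c₀(v) and c₁ = c₁(v) such that c₀·‖M‖_F ≤ ‖M·v‖_∞ ≤ c₁·‖M‖_F for every element M of the Apollonian group (every finite product of the generators S₁, S₂, S₃, S₄), where ‖M‖_F = (∑_{i,j} M_{ij}²)^{1/2} is the Frobenius norm and ‖w‖_∞ is the maximum of the absolute values of the entries of w. -/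
/-- The generators `S₁, S₂, S₃, S₄` of the Apollonian group.  `S i` agrees with
the identity matrix except in row `i`, which has `-1` on the diagonal and `2`
in the other positions. -/
def S (i : Fin 4) : Matrix (Fin 4) (Fin 4) ℤ :=
  Matrix.of fun k l => if k = i then (if l = i then -1 else 2) else (if k = l then 1 else 0)

open Matrix

theorem S_mul_self (i : Fin 4) : S i * S i = 1 := by
  revert i; decide

/-- Every element of the Apollonian group is the product of a reduced word. -/
theorem exists_isChain_prod_map_S_eq (l : List (Fin 4)) :
    ∃ l' : List (Fin 4), l'.IsChain (· ≠ ·) ∧ (l'.map S).prod = (l.map S).prod := by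
  induction l with
  | nil => exact ⟨[], List.isChain_nil, rfl⟩
  | cons i l ih =>
    obtain ⟨l', hl', h⟩ := ih
    cases l' with
    | nil => exact ⟨[i], List.isChain_singleton i, by simp [← h]⟩
    | cons j m =>
      by_cases hij : i = j
      · refine ⟨m, hl'.tail, ?_⟩
        rw [List.map_cons, List.prod_cons, ← h, List.map_cons, List.prod_cons, ← mul_assoc, hij,
          S_mul_self, one_mul]
      · exact ⟨i :: j :: m, List.isChain_cons_cons.2 ⟨hij, hl'⟩, by simp [← h]⟩

theorem S_mulVec_self (i : Fin 4) (x : Fin 4 → ℤ) :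
    (S i *ᵥ x) i = 2 * (x 0 + x 1 + x 2 + x 3) - 3 * x i := by
  fin_cases i <;> simp [S, mulVec, dotProduct, Fin.sum_univ_four] <;> ring

theorem S_mulVec_of_ne {i k : Fin 4} (h : k ≠ i) (x : Fin 4 → ℤ) : (S i *ᵥ x) k = x k := by
  simp [S, mulVec, dotProduct, h]

/-- The vector `x` is positive and its `i`-th entry is the largest one. -/
def IsPosMaxAt (x : Fin 4 → ℤ) (i : Fin 4) : Prop :=
  ∀ k, 1 ≤ x k ∧ x k ≤ x i

theorem IsPosMaxAt.S_mulVec {x : Fin 4 → ℤ} {i j : Fin 4} (h : IsPosMaxAt x i) (hij : j ≠ i) :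
    IsPosMaxAt (S j *ᵥ x) j := by
  have h0 := h 0
  have h1 := h 1
  have h2 := h 2
  have h3 := h 3
  have key : ∀ k, x k ≤ 2 * (x 0 + x 1 + x 2 + x 3) - 3 * x j := by
    intro k
    fin_cases i <;> fin_cases j <;> first | exact absurd rfl hij | skip
    all_goals fin_cases k <;> simp at * <;> omega
  intro k
  by_cases hk : k = j
  · subst hk
    exact ⟨by rw [S_mulVec_self]; linarith [key i, (h i).1], le_rfl⟩
  · rw [S_mulVec_of_ne hk, S_mulVec_self]
    exact ⟨(h k).1, key k⟩

theorem isPosMaxAt_mulVec_one (i : Fin 4) (l : List (Fin 4)) (hl : (i :: l).IsChain (· ≠ ·)) :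
    IsPosMaxAt (((i :: l).map S).prod *ᵥ 1) i := by
  induction l generalizing i with
  | nil =>
    intro k
    revert i k
    simp
    decide
  | cons j l ih =>
    rw [List.isChain_cons_cons] at hl
    rw [List.map_cons, List.prod_cons, ← mulVec_mulVec]
    exact (ih j hl.2).S_mulVec hl.1

theorem one_le_prod_mulVec_one (l : List (Fin 4)) (k : Fin 4) :
    1 ≤ ((l.map S).prod *ᵥ 1) k := by
  obtain ⟨l', hl', h⟩ := exists_isChain_prod_map_S_eq l
  rw [← h]
  cases l' with
  | nil => simp
  | cons i m => exact (isPosMaxAt_mulVec_one i m hl' k).1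

theorem isPosMaxAt_or_row_zero_eq (i : Fin 4) (l : List (Fin 4))
    (hl : (i :: l).IsChain (· ≠ ·)) :
    IsPosMaxAt (((i :: l).map S).prod *ᵥ ![-1, 1, 1, 1]) i ∨
      ((i :: l).map S).prod *ᵥ ![-1, 1, 1, 1] = ![-1, 1, 1, 1] ∧
        ((i :: l).map S).prod 0 = Pi.single 0 1 := by
  have step (i : Fin 4) (M : Matrix (Fin 4) (Fin 4) ℤ)
      (h : M *ᵥ ![-1, 1, 1, 1] = ![-1, 1, 1, 1]) (hM : M 0 = Pi.single 0 1) :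
      IsPosMaxAt ((S i * M) *ᵥ ![-1, 1, 1, 1]) i ∨
        (S i * M) *ᵥ ![-1, 1, 1, 1] = ![-1, 1, 1, 1] ∧ (S i * M) 0 = Pi.single 0 1 := by
    rw [← mulVec_mulVec, h]
    by_cases hi : i = 0
    · subst hi
      left
      intro k
      revert k
      decide
    · right
      constructor
      · revert i
        decide
      · rw [← hM]
        ext j
        simp [S, mul_apply, Ne.symm hi]
  induction l generalizing i with
  | nil => simpa using step i 1 (one_mulVec _) (by ext j; revert j; decide)
  | cons j l ih =>
    rw [List.isChain_cons_cons] at hl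
    rw [List.map_cons, List.prod_cons]
    rcases ih j hl.2 with h | ⟨h, hM⟩
    · left
      rw [← mulVec_mulVec]
      exact h.S_mulVec hl.1
    · exact step i _ h hM

theorem one_le_prod_mulVec_or_row_eq (l : List (Fin 4)) (k : Fin 4) :
    1 ≤ ((l.map S).prod *ᵥ ![-1, 1, 1, 1]) k ∨ (l.map S).prod k = Pi.single 0 1 := by
  have aux (M : Matrix (Fin 4) (Fin 4) ℤ) (h : M *ᵥ ![-1, 1, 1, 1] = ![-1, 1, 1, 1])
      (hM : M 0 = Pi.single 0 1) :
      1 ≤ (M *ᵥ ![-1, 1, 1, 1]) k ∨ M k = Pi.single 0 1 := by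
    rw [h]
    by_cases hk : k = 0
    · exact Or.inr (hk ▸ hM)
    · left
      revert k
      decide
  obtain ⟨l', hl', h⟩ := exists_isChain_prod_map_S_eq l
  rw [← h]
  cases l' with
  | nil => exact aux 1 (one_mulVec _) (by ext j; revert j; decide)
  | cons i m =>
    rcases isPosMaxAt_or_row_zero_eq i m hl' with h | ⟨h, hM⟩
    · exact Or.inl (h k).1
    · exact aux _ h hM

/-- The dual Descartes form takes the value `1` on every row of an element of the group. -/
theorem two_mul_sum_sq_row (l : List (Fin 4)) (k : Fin 4) :
    2 * ∑ j, (l.map S).prod k j ^ 2 = (∑ j, (l.map S).prod k j) ^ 2 + 1 := by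
  let G : Matrix (Fin 4) (Fin 4) ℤ := Matrix.of fun i j => if i = j then 1 else -1
  have hS : ∀ i, S i * G * (S i)ᵀ = G := by decide
  have hG : (l.map S).prod * G * (l.map S).prodᵀ = G := by
    induction l with
    | nil => simp
    | cons i l ih =>
      rw [List.map_cons, List.prod_cons, transpose_mul]
      calc S i * (l.map S).prod * G * ((l.map S).prodᵀ * (S i)ᵀ)
          = S i * ((l.map S).prod * G * (l.map S).prodᵀ) * (S i)ᵀ := by
            simp only [Matrix.mul_assoc]
        _ = G := by rw [ih, hS]
  have h := congrFun (congrFun hG k) k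
  simp only [G, mul_apply, transpose_apply, of_apply, Fin.sum_univ_four, if_true] at h
  simp at h
  simp only [Fin.sum_univ_four]
  linarith

theorem prod_map_S_mulVec_ne_zero (l : List (Fin 4)) {x : Fin 4 → ℤ} (hx : x ≠ 0) :
    (l.map S).prod *ᵥ x ≠ 0 := by
  induction l with
  | nil => simpa
  | cons i l ih =>
    intro h
    apply ih
    rw [List.map_cons, List.prod_cons, ← mulVec_mulVec] at h
    rw [← one_mulVec ((l.map S).prod *ᵥ x), ← S_mul_self i, ← mulVec_mulVec, h, mulVec_zero]

/-- A vector of positive coordinate sum, norm `1` for the dual Descartes form, and separated from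
the zeroth basis vector pairs with a Descartes quadruple with negative zeroth entry to a value
bounded below by the coordinate sum. -/
theorem sum_le_mul_of_descartes {v r : Fin 4 → ℤ} {s σ N : ℤ}
    (hσ : v 0 + v 1 + v 2 + v 3 = σ) (hs : r 0 + r 1 + r 2 + r 3 = s)
    (hD : 2 * (v 0 ^ 2 + v 1 ^ 2 + v 2 ^ 2 + v 3 ^ 2) = σ ^ 2)
    (hr : 2 * (r 0 ^ 2 + r 1 ^ 2 + r 2 ^ 2 + r 3 ^ 2) = s ^ 2 + 1)
    (ha : v 0 < 0) (hσ0 : 0 < σ) (hs0 : 0 < s) (ht : 1 ≤ s - 2 * r 0) (hN : 1 ≤ N)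
    (hrv : r 0 * v 0 + r 1 * v 1 + r 2 * v 2 + r 3 * v 3 ≤ N) : s ≤ 2 * σ * N := by
  rcases lt_or_ge (4 * s * -v 0) σ with h | h
  · nlinarith
  · set p := r 0 * v 0 + r 1 * v 1 + r 2 * v 2 + r 3 * v 3 with hp
    have hz : (2 * σ * r 0 + 2 * s * v 0 - s * σ) ^ 2 + (2 * σ * r 1 + 2 * s * v 1 - s * σ) ^ 2 +
        (2 * σ * r 2 + 2 * s * v 2 - s * σ) ^ 2 + (2 * σ * r 3 + 2 * s * v 3 - s * σ) ^ 2 =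
        2 * σ ^ 2 + 8 * s * σ * p := by
      rw [hp]
      linear_combination 2 * σ ^ 2 * hr + 2 * s ^ 2 * hD - 4 * s * σ ^ 2 * hs - 4 * s ^ 2 * σ * hσ
    have hz0 : (σ - 2 * s * v 0) ^ 2 ≤ (2 * σ * r 0 + 2 * s * v 0 - s * σ) ^ 2 := by
      have h1 : 0 ≤ σ - 2 * s * v 0 := by nlinarith
      have h2 : σ - 2 * s * v 0 ≤ -(2 * σ * r 0 + 2 * s * v 0 - s * σ) := by nlinarith
      rw [← neg_sq (2 * σ * r 0 + 2 * s * v 0 - s * σ)]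
      exact pow_le_pow_left₀ h1 h2 2
    have h1 : 4 * s ^ 2 * v 0 ^ 2 ≤ 8 * s * σ * p := by
      have h4 : σ * σ ≤ σ * (4 * s * -v 0) := mul_le_mul_of_nonneg_left h hσ0.le
      linarith [sq_nonneg (2 * σ * r 1 + 2 * s * v 1 - s * σ),
        sq_nonneg (2 * σ * r 2 + 2 * s * v 2 - s * σ),
        sq_nonneg (2 * σ * r 3 + 2 * s * v 3 - s * σ)]
    have h2 : s * v 0 ^ 2 ≤ 2 * σ * p := by
      have : 4 * s * (s * v 0 ^ 2) ≤ 4 * s * (2 * σ * p) := by linarith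
      exact le_of_mul_le_mul_left this (by linarith)
    have h3 : 1 ≤ v 0 ^ 2 := by nlinarith
    nlinarith


/-- **Norm comparison for the Apollonian group acting on a root quadruple.**
Let `v = (a,b,c,d)` be an integer root quadruple with `a < 0`.  Then there are
positive constants `c₀, c₁` (depending on `v`) such that
`c₀ ‖M‖_F ≤ ‖M·v‖_∞ ≤ c₁ ‖M‖_F` for every element `M` of the Apollonian group,
i.e. every finite product `M = (l.map S).prod` of the generators. -/
theorem apollonian_norm_comparison (v : Fin 4 → ℤ)
    (hD : 2 * (v 0 ^ 2 + v 1 ^ 2 + v 2 ^ 2 + v 3 ^ 2) = (v 0 + v 1 + v 2 + v 3) ^ 2)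
    (ha : v 0 < 0) (hb : 0 ≤ v 1) (hbc : v 1 ≤ v 2) (hcd : v 2 ≤ v 3)
    (hsum : 0 < v 0 + v 1 + v 2 + v 3) (hroot : v 3 ≤ v 0 + v 1 + v 2) :
    ∃ c₀ c₁ : ℝ, 0 < c₀ ∧ 0 < c₁ ∧ ∀ l : List (Fin 4),
      c₀ * Real.sqrt (∑ i, ∑ j, ((l.map S).prod i j : ℝ) ^ 2) ≤
        ((Finset.univ.sup' Finset.univ_nonempty fun i => |((l.map S).prod.mulVec v) i| : ℤ) : ℝ) ∧
      ((Finset.univ.sup' Finset.univ_nonempty fun i => |((l.map S).prod.mulVec v) i| : ℤ) : ℝ) ≤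
        c₁ * Real.sqrt (∑ i, ∑ j, ((l.map S).prod i j : ℝ) ^ 2) := by
  set σ := v 0 + v 1 + v 2 + v 3 with hσ
  have hσR : (0 : ℝ) < σ := by exact_mod_cast hsum
  refine ⟨1 / (4 * σ), ∑ j, |(v j : ℝ)|, by positivity, ?_, fun l => ?_⟩
  · refine Finset.sum_pos' (fun j _ => abs_nonneg _) ⟨0, Finset.mem_univ 0, ?_⟩
    exact abs_pos.2 (by exact_mod_cast ha.ne)
  set M := (l.map S).prod with hM
  set N : ℤ := Finset.univ.sup' Finset.univ_nonempty fun i => |(M *ᵥ v) i| with hN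
  have hle : ∀ k, |(M *ᵥ v) k| ≤ N := fun k =>
    Finset.le_sup' (fun i => |(M *ᵥ v) i|) (Finset.mem_univ k)
  constructor
  · have hN1 : 1 ≤ N := by
      have hv : v ≠ 0 := fun h => by simp [h] at ha
      obtain ⟨k, hk⟩ := Function.ne_iff.1 (prod_map_S_mulVec_ne_zero l hv)
      exact (Int.one_le_abs hk).trans (hle k)
    have hrow : ∀ k, ∑ j, M k j ^ 2 ≤ (2 * σ * N) ^ 2 := by
      intro k
      have h1 := two_mul_sum_sq_row l k
      have h2 := one_le_prod_mulVec_one l k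
      have hs : ∑ j, M k j ≤ 2 * σ * N := by
        rcases one_le_prod_mulVec_or_row_eq l k with ht | ht
        · rw [← hM] at h1 h2 ht
          simp only [mulVec, dotProduct, Fin.sum_univ_four, Pi.one_apply, mul_one] at h1 h2 ht ⊢
          refine sum_le_mul_of_descartes rfl rfl hD h1 ha hsum (by linarith) ?_ hN1
            (le_trans ?_ ((le_abs_self _).trans (hle k)))
          · simp at ht
            linarith
          · simp [mulVec, dotProduct, Fin.sum_univ_four]
        · rw [← hM] at ht
          rw [ht, Finset.sum_pi_single']
          simp only [Finset.mem_univ, if_true]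
          nlinarith
      rw [← hM] at h1 h2
      simp only [mulVec, dotProduct, Pi.one_apply, mul_one] at h2
      nlinarith
    have hsum_sq : (∑ i, ∑ j, (M i j : ℝ) ^ 2) ≤ (4 * σ * N) ^ 2 := by
      have h : ∑ i, ∑ j, M i j ^ 2 ≤ (4 * σ * N) ^ 2 := by
        refine (Finset.sum_le_sum fun k _ => hrow k).trans_eq ?_
        simp
        ring
      exact_mod_cast h
    have hNR : (1 : ℝ) ≤ N := by exact_mod_cast hN1
    rw [one_div, inv_mul_le_iff₀ (by positivity)]
    exact Real.sqrt_le_iff.2 ⟨by positivity, hsum_sq⟩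
  · obtain ⟨k, -, hk⟩ := Finset.exists_mem_eq_sup' Finset.univ_nonempty fun i => |(M *ᵥ v) i|
    rw [hN, hk]
    have hentry : ∀ j, |(M k j : ℝ)| ≤ √(∑ i, ∑ j, (M i j : ℝ) ^ 2) := by
      intro j
      apply Real.abs_le_sqrt
      calc (M k j : ℝ) ^ 2 ≤ ∑ j, (M k j : ℝ) ^ 2 :=
            Finset.single_le_sum (f := fun j => (M k j : ℝ) ^ 2) (fun _ _ => sq_nonneg _)
              (Finset.mem_univ j)
        _ ≤ ∑ i, ∑ j, (M i j : ℝ) ^ 2 :=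
            Finset.single_le_sum (f := fun i => ∑ j, (M i j : ℝ) ^ 2)
              (fun _ _ => Finset.sum_nonneg fun _ _ => sq_nonneg _) (Finset.mem_univ k)
    simp only [mulVec, dotProduct]
    push_cast
    refine (Finset.abs_sum_le_sum_abs _ _).trans ?_
    rw [Finset.sum_mul]
    refine Finset.sum_le_sum fun j _ => ?_
    rw [abs_mul, mul_comm]
    exact mul_le_mul_of_nonneg_left (hentry j) (abs_nonneg _)
end

section
/- Every primitive integer Descartes quadruple (a,b,c,d) with a+b+c+d > 0 is congruent modulo 12, after a suitable permutation of its entries, to one of the following twenty quadruples: (0,0,1,1), (0,1,1,4), (0,1,4,9), (1,4,4,9), (4,4,9,9); (6,6,11,11), (2,6,11,11), (2,3,6,11), (2,2,3,11), (2,2,3,3); (3,3,10,10), (3,6,7,10), (3,7,10,10), (6,7,7,10), (6,6,7,7); (0,0,5,5), (0,5,5,8), (0,5,8,9), (5,8,8,9), (8,8,9,9). In particular, eight residue classes mod 12 never occur among the entries of such quadruples lying over a fixed orbit of the Apollonian group. -/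
/-- In a primitive Descartes quadruple of positive sum, the sum of an even and an odd entry is
positive and a sum of two squares, hence is `1` modulo `4`. -/
theorem descartes_even_add_odd {a b c d : ℤ}
    (hD : 2 * (a ^ 2 + b ^ 2 + c ^ 2 + d ^ 2) = (a + b + c + d) ^ 2)
    (hsum : 0 < a + b + c + d)
    (hprim : ∀ p : ℕ, p.Prime → (p : ℤ) ∣ a → (p : ℤ) ∣ b → (p : ℤ) ∣ c → ¬ (p : ℤ) ∣ d)
    (ha : Even a) (hb : Odd b) : (a + b) % 4 = 1 := by
  have hodd : Odd (a + b) := ha.add_odd hb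
  have hpos : 0 < a + b := by
    have h0 : a + b ≠ 0 := by
      intro h
      rw [h] at hodd
      exact absurd hodd (by decide)
    by_contra! hneg
    nlinarith [sq_nonneg (a - b), sq_nonneg (c - d), lt_of_le_of_ne hneg h0]
  obtain ⟨m, hm⟩ : Even (a + b + c - d) := by
    have h : Even ((a + b + c + d) ^ 2) := hD ▸ even_two_mul _
    have h' : Even (a + b + c + d) := (Int.even_pow.1 h).1
    have : a + b + c - d = a + b + c + d - 2 * d := by ring
    rw [this]
    exact h'.sub (even_two_mul d)
  have hprod : (a + b) * (a + c) = a ^ 2 + m ^ 2 := by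
    obtain rfl : d = a + b + c - 2 * m := by linarith
    linarith
  obtain ⟨x, y, hxy⟩ : ∃ x y : ℕ, (a + b).natAbs = x ^ 2 + y ^ 2 := by
    rw [Nat.eq_sq_add_sq_iff]
    intro q hq hq3
    have hqp := Nat.prime_of_mem_primeFactors hq
    have : Fact q.Prime := ⟨hqp⟩
    have hqA : (q : ℤ) ∣ a + b := Int.natCast_dvd.2 (Nat.dvd_of_mem_primeFactors hq)
    by_contra hval
    have hqC : (q : ℤ) ∣ a + c := by
      by_cases hC : a + c = 0
      · simp [hC]
      have hAC : ((a + b) * (a + c)).natAbs = a.natAbs ^ 2 + m.natAbs ^ 2 := by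
        zify
        rw [hprod, abs_of_nonneg (by positivity), sq_abs, sq_abs]
      have heven : Even (padicValNat q ((a + b) * (a + c)).natAbs) := by
        refine Nat.eq_sq_add_sq_iff.1 ⟨_, _, hAC⟩ _ (Nat.mem_primeFactors.2 ⟨hqp, ?_, ?_⟩) hq3
        · exact Int.natCast_dvd.1 (hqA.mul_right _)
        · exact Int.natAbs_ne_zero.2 (mul_ne_zero hpos.ne' hC)
      rw [Int.natAbs_mul, padicValNat.mul (by omega) (by omega), Nat.even_add] at heven
      refine Int.natCast_dvd.2 (dvd_of_one_le_padicValNat ?_)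
      by_contra! h0
      exact hval (heven.2 (by simp [Nat.lt_one_iff.1 h0]))
    have hsq : (a : ZMod q) ^ 2 + (m : ZMod q) ^ 2 = 0 := by
      have := (ZMod.intCast_zmod_eq_zero_iff_dvd _ q).2 (hprod ▸ hqA.mul_right (a + c))
      exact_mod_cast this
    have hqa : (q : ℤ) ∣ a := by
      rw [← ZMod.intCast_zmod_eq_zero_iff_dvd]
      by_contra h
      exact ZMod.mod_four_ne_three_of_sq_eq_neg_sq' (x := (m : ZMod q)) h
        (by linear_combination hsq) hq3
    have hqm : (q : ℤ) ∣ m := by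
      rw [← ZMod.intCast_zmod_eq_zero_iff_dvd]
      by_contra h
      exact ZMod.mod_four_ne_three_of_sq_eq_neg_sq' (x := (a : ZMod q)) h
        (by linear_combination hsq) hq3
    have hqb := (dvd_add_right hqa).1 hqA
    have hqc := (dvd_add_right hqa).1 hqC
    refine hprim q hqp hqa hqb hqc ?_
    have : d = a + b + c - (m + m) := by linarith
    rw [this]
    exact ((hqA.add hqc).sub (hqm.add hqm))
  have hxy' : a + b = (x : ℤ) ^ 2 + (y : ℤ) ^ 2 := by
    rw [← Int.natAbs_of_nonneg hpos.le, hxy]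
    push_cast
    ring
  rw [hxy'] at hodd ⊢
  rcases Int.even_or_odd' (x : ℤ) with ⟨k, hk | hk⟩ <;>
    rcases Int.even_or_odd' (y : ℤ) with ⟨l, hl | hl⟩ <;>
    rw [hk, hl] at hodd ⊢ <;> ring_nf at hodd ⊢ <;> obtain ⟨t, ht⟩ := hodd <;> omega

/-- The twenty residue classes of Descartes quadruples modulo `12`. -/
def descartesClasses : Finset (Fin 4 → ZMod 12) :=
  {![0,0,1,1], ![0,1,1,4], ![0,1,4,9], ![1,4,4,9], ![4,4,9,9],
   ![6,6,11,11], ![2,6,11,11], ![2,3,6,11], ![2,2,3,11], ![2,2,3,3],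
   ![3,3,10,10], ![3,6,7,10], ![3,7,10,10], ![6,7,7,10], ![6,6,7,7],
   ![0,0,5,5], ![0,5,5,8], ![0,5,8,9], ![5,8,8,9], ![8,8,9,9]}

theorem exists_perm_mem_descartesClasses :
    ∀ a : ZMod 12, 6 * a = 0 → ∀ c, 3 * (a + c) = 3 → ∀ b, 3 * (b + c) = 3 →
      ∀ d, 3 * (a + d) = 3 →
      2 * (a ^ 2 + b ^ 2 + c ^ 2 + d ^ 2) = (a + b + c + d) ^ 2 →
      ¬ (4 * a = 0 ∧ 4 * b = 0 ∧ 4 * c = 0 ∧ 4 * d = 0) →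
      ∃ σ : Equiv.Perm (Fin 4), (fun i => ![a, b, c, d] (σ i)) ∈ descartesClasses := by
  decide +kernel

/-- The claim modulo `12` for quadruples whose first two entries are even and last two odd. -/
theorem descartes_mod_twelve_of_parity (w : Fin 4 → ℤ)
    (hD : 2 * ∑ i, w i ^ 2 = (∑ i, w i) ^ 2) (hsum : 0 < ∑ i, w i)
    (hprim : ∀ p : ℕ, p.Prime → ∃ i, ¬ (p : ℤ) ∣ w i)
    (h0 : Even (w 0)) (h1 : Even (w 1)) (h2 : Odd (w 2)) (h3 : Odd (w 3)) :
    ∃ σ : Equiv.Perm (Fin 4), (fun i => (w (σ i) : ZMod 12)) ∈ descartesClasses := by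
  simp only [Fin.sum_univ_four] at hD hsum
  have hprim' : ∀ p : ℕ, p.Prime →
      ¬ ((p : ℤ) ∣ w 0 ∧ (p : ℤ) ∣ w 1 ∧ (p : ℤ) ∣ w 2 ∧ (p : ℤ) ∣ w 3) := by
    intro p hp h
    obtain ⟨i, hi⟩ := hprim p hp
    fin_cases i <;> simp_all
  have h02 : (w 0 + w 2) % 4 = 1 :=
    descartes_even_add_odd (c := w 1) (d := w 3) (by linarith) (by linarith)
      (fun p hp _ _ _ _ => hprim' p hp (by tauto)) h0 h2
  have h12 : (w 1 + w 2) % 4 = 1 :=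
    descartes_even_add_odd (c := w 0) (d := w 3) (by linarith) (by linarith)
      (fun p hp _ _ _ _ => hprim' p hp (by tauto)) h1 h2
  have h03 : (w 0 + w 3) % 4 = 1 :=
    descartes_even_add_odd (c := w 1) (d := w 2) (by linarith) (by linarith)
      (fun p hp _ _ _ _ => hprim' p hp (by tauto)) h0 h3
  have hthree : ∀ x : ℤ, x % 4 = 1 → (3 * x : ZMod 12) = 3 := by
    intro x hx
    have := (ZMod.intCast_eq_intCast_iff_dvd_sub (3 * x) 3 12).2 (by push_cast; omega)
    exact_mod_cast this
  have hfour : ∀ x : ℤ, (4 * x : ZMod 12) = 0 → (3 : ℤ) ∣ x := by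
    intro x hx
    have := (ZMod.intCast_zmod_eq_zero_iff_dvd (4 * x) 12).1 (by exact_mod_cast hx)
    push_cast at this
    omega
  have hsix : (6 * w 0 : ZMod 12) = 0 := by
    obtain ⟨k, hk⟩ := h0
    have := (ZMod.intCast_zmod_eq_zero_iff_dvd (6 * w 0) 12).2 (by push_cast; omega)
    exact_mod_cast this
  obtain ⟨σ, hσ⟩ := exists_perm_mem_descartesClasses (w 0) hsix
    (w 2) (by exact_mod_cast hthree _ h02) (w 1) (by exact_mod_cast hthree _ h12)
    (w 3) (by exact_mod_cast hthree _ h03)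
    (by exact_mod_cast congrArg (Int.cast : ℤ → ZMod 12) hD)
    (fun h => hprim' 3 Nat.prime_three
      ⟨hfour _ h.1, hfour _ h.2.1, hfour _ h.2.2.1, hfour _ h.2.2.2⟩)
  refine ⟨σ, ?_⟩
  have hw : ∀ i, (w i : ZMod 12) = ![(w 0 : ZMod 12), w 1, w 2, w 3] i := by
    intro i
    fin_cases i <;> rfl
  rwa [funext fun i => hw (σ i)]

theorem exists_perm_parity :
    ∀ f : Fin 4 → ZMod 2, ∑ i, f i = 0 → (∃ i, f i ≠ 0) → (∃ i, f i ≠ 1) →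
      ∃ τ : Equiv.Perm (Fin 4), f (τ 0) = 0 ∧ f (τ 1) = 0 ∧ f (τ 2) = 1 ∧ f (τ 3) = 1 := by
  decide +kernel

/-- **Congruence restrictions mod 12.** Every primitive integer Descartes
quadruple with positive entry-sum is congruent modulo 12, after a suitable
permutation of its entries, to one of twenty explicit quadruples. -/
theorem descartes_mod_twelve (v : Fin 4 → ℤ)
    (hD : 2 * (v 0 ^ 2 + v 1 ^ 2 + v 2 ^ 2 + v 3 ^ 2) = (v 0 + v 1 + v 2 + v 3) ^ 2)
    (hprim : Finset.univ.gcd v = 1)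
    (hsum : 0 < v 0 + v 1 + v 2 + v 3) :
    ∃ σ : Equiv.Perm (Fin 4),
      (fun i => ((v (σ i) : ZMod 12))) ∈
        ({![0,0,1,1], ![0,1,1,4], ![0,1,4,9], ![1,4,4,9], ![4,4,9,9],
           ![6,6,11,11], ![2,6,11,11], ![2,3,6,11], ![2,2,3,11], ![2,2,3,3],
           ![3,3,10,10], ![3,6,7,10], ![3,7,10,10], ![6,7,7,10], ![6,6,7,7],
           ![0,0,5,5], ![0,5,5,8], ![0,5,8,9], ![5,8,8,9], ![8,8,9,9]} :
          Set (Fin 4 → ZMod 12)) := by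
  have hprime : ∀ p : ℕ, p.Prime → ∃ i, ¬ (p : ℤ) ∣ v i := by
    intro p hp
    by_contra! h
    have h1 : (p : ℤ) ∣ 1 := hprim ▸ Finset.dvd_gcd fun i _ => h i
    exact hp.one_lt.ne' (Nat.dvd_one.1 (by exact_mod_cast h1))
  have hEven : Even (v 0 + v 1 + v 2 + v 3) := by
    have h : Even ((v 0 + v 1 + v 2 + v 3) ^ 2) := hD ▸ even_two_mul _
    exact (Int.even_pow.1 h).1
  obtain ⟨τ, t0, t1, t2, t3⟩ := exists_perm_parity (fun i => (v i : ZMod 2))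
    (by
      rw [Fin.sum_univ_four]
      exact_mod_cast (ZMod.intCast_eq_zero_iff_even).2 hEven)
    (by
      obtain ⟨i, hi⟩ := hprime 2 Nat.prime_two
      exact ⟨i, fun h => hi ((ZMod.intCast_zmod_eq_zero_iff_dvd _ 2).1 h)⟩)
    (by
      by_contra! h
      have hodd : ∀ i, Odd (v i) := fun i => ZMod.intCast_eq_one_iff_odd.1 (h i)
      obtain ⟨s, hs⟩ := hEven
      have hmod (i : Fin 4) := Int.eight_dvd_sq_sub_one_of_odd (hodd i)
      have hs4 : v 0 ^ 2 + v 1 ^ 2 + v 2 ^ 2 + v 3 ^ 2 = 2 * s ^ 2 := by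
        rw [hs] at hD
        linarith
      have h0 := hmod 0
      have h1 := hmod 1
      have h2 := hmod 2
      have h3 := hmod 3
      rcases Int.even_or_odd s with ⟨t, rfl⟩ | hs'
      · ring_nf at hs4
        omega
      · have := Int.eight_dvd_sq_sub_one_of_odd hs'
        omega)
  obtain ⟨σ, hσ⟩ := descartes_mod_twelve_of_parity (fun i => v (τ i))
    (by
      rw [Equiv.sum_comp τ fun i => v i ^ 2, Equiv.sum_comp τ v]
      simpa only [Fin.sum_univ_four] using hD)
    (by
      rw [Equiv.sum_comp τ v]
      simpa only [Fin.sum_univ_four] using hsum)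
    (fun p hp => by
      obtain ⟨i, hi⟩ := hprime p hp
      exact ⟨τ.symm i, by simpa using hi⟩)
    (ZMod.intCast_eq_zero_iff_even.1 t0) (ZMod.intCast_eq_zero_iff_even.1 t1)
    (ZMod.intCast_eq_one_iff_odd.1 t2) (ZMod.intCast_eq_one_iff_odd.1 t3)
  refine ⟨σ.trans τ, ?_⟩
  simpa [descartesClasses] using hσ
end

section
/- Let v be a primitive integer Descartes quadruple with positive entry-sum, and let m be a positive integer with gcd(m,30) = 1. Then for every residue class k modulo m, there exist a finite product M of the generators S₁, S₂, S₃, S₄ and an index i ∈ {1,2,3,4} such that (M·v)_i ≡ k (mod m). (That is, every residue class modulo m occurs as the curvature of some circle in the primitive integral Apollonian packing generated by v.) -/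
/-- A relation on integer quadruples which is preserved by replacing any one entry by the other
root of the Descartes equation. -/
def FlipClosed (T : ℤ → ℤ → ℤ → ℤ → Prop) : Prop :=
  ∀ a b c d, T a b c d →
    T (2 * (b + c + d) - a) b c d ∧ T a (2 * (a + c + d) - b) c d ∧
    T a b (2 * (a + b + d) - c) d ∧ T a b c (2 * (a + b + c) - d)

theorem FlipClosed.swap {T : ℤ → ℤ → ℤ → ℤ → Prop} (hT : FlipClosed T) :
    FlipClosed fun a b c d => T b a c d := by
  intro a b c d h
  obtain ⟨h0, h1, h2, h3⟩ := hT b a c d h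
  exact ⟨h1, h0, by rwa [add_comm a b], by rwa [add_comm a b]⟩

/-- The quadruples `(a, f u - a, f v - a, f (u + v) - a)` attached to a binary quadratic form `f`
with coefficients `A, B, C` in a basis `u, v`, under the change of basis `v ↦ v + 2 n u`. -/
theorem FlipClosed.upper {T : ℤ → ℤ → ℤ → ℤ → Prop} (hT : FlipClosed T) {a A B C : ℤ}
    (h : T a (A - a) (C - a) (A + B + C - a)) (n : ℕ) {t : ℤ} (ht : t = 2 * n) :
    T a (A - a) (C + t * B + t ^ 2 * A - a)
      (A + (B + 2 * t * A) + (C + t * B + t ^ 2 * A) - a) := by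
  subst ht
  induction n with
  | zero => simpa using h
  | succ n ih =>
    have h' := (hT _ _ _ _ (hT _ _ _ _ ih).2.2.1).2.2.2
    convert h' using 1 <;> push_cast <;> ring

theorem FlipClosed.lower {T : ℤ → ℤ → ℤ → ℤ → Prop} (hT : FlipClosed T) {a A B C : ℤ}
    (h : T a (A - a) (C - a) (A + B + C - a)) (n : ℕ) {t : ℤ} (ht : t = 2 * n) :
    T a (A + t * B + t ^ 2 * C - a) (C - a)
      ((A + t * B + t ^ 2 * C) + (B + 2 * t * C) + C - a) := by
  subst ht
  induction n with
  | zero => simpa using h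
  | succ n ih =>
    have h' := (hT _ _ _ _ (hT _ _ _ _ ih).2.1).2.2.2
    convert h' using 1 <;> push_cast <;> ring

theorem exists_two_mul_nat_modEq {m : ℕ} (hodd : Odd m) (r : ℤ) :
    ∃ n : ℕ, (2 * n : ℤ) ≡ r [ZMOD m] := by
  obtain ⟨j, rfl⟩ := hodd
  have hpos : (0 : ℤ) < (2 * j + 1 : ℕ) := by positivity
  refine ⟨((r * (j + 1)) % (2 * j + 1 : ℕ)).toNat, ?_⟩
  rw [Int.toNat_of_nonneg (Int.emod_nonneg _ hpos.ne')]
  refine ((Int.mod_modEq _ _).mul_left 2).trans ?_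
  exact (Int.modEq_iff_dvd.2 ⟨-r, by push_cast; ring⟩)

theorem exists_mul_modEq_one {m : ℕ} {s : ℤ} (hs : ∀ p : ℕ, p.Prime → p ∣ m → ¬ (p : ℤ) ∣ s) :
    ∃ s' : ℤ, s * s' ≡ 1 [ZMOD m] := by
  have hc : IsCoprime s (m : ℤ) := by
    rw [Int.isCoprime_iff_gcd_eq_one]
    by_contra hg
    obtain ⟨p, hp, hpg⟩ := Nat.exists_prime_and_dvd hg
    have hpg' : (p : ℤ) ∣ (Int.gcd s m : ℤ) := Int.natCast_dvd_natCast.2 hpg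
    exact hs p hp (Int.natCast_dvd_natCast.1 (hpg'.trans (Int.gcd_dvd_right _ _)))
      (hpg'.trans (Int.gcd_dvd_left _ _))
  obtain ⟨u, w, h⟩ := hc
  exact ⟨u, Int.modEq_iff_dvd.2 ⟨w, by linear_combination -h⟩⟩

/-- Simultaneous congruences modulo the prime divisors of `m`. -/
theorem exists_forall_prime_cast_eq {m : ℕ} (hm : 0 < m) (g : ∀ p : ℕ, ZMod p) :
    ∃ x : ℤ, ∀ p : ℕ, p.Prime → p ∣ m → (x : ZMod p) = g p := by
  obtain ⟨x, hx⟩ := Nat.chineseRemainderOfFinset (fun p => (g p).val) id m.primeFactors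
    (fun p hp => (Nat.prime_of_mem_primeFactors hp).ne_zero)
    (fun p hp q hq hpq => (Nat.coprime_primes (Nat.prime_of_mem_primeFactors hp)
      (Nat.prime_of_mem_primeFactors hq)).2 hpq)
  refine ⟨x, fun p hp hpm => ?_⟩
  have : NeZero p := ⟨hp.ne_zero⟩
  have h := (ZMod.natCast_eq_natCast_iff _ _ _).2 (hx p (Nat.mem_primeFactors.2 ⟨hp, hpm, hm.ne'⟩))
  simpa using h

/-- Every value of the form `f` at a vector that is primitive modulo `m` occurs, up to the shift
by `a`, as a second entry. -/
theorem FlipClosed.exists_modEq_form {T : ℤ → ℤ → ℤ → ℤ → Prop} (hT : FlipClosed T)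
    {a A B C : ℤ} (h : T a (A - a) (C - a) (A + B + C - a)) {m : ℕ} (hm : 0 < m) (hodd : Odd m)
    {x y : ℤ} (hxy : ∀ p : ℕ, p.Prime → p ∣ m → ¬ ((p : ℤ) ∣ x ∧ (p : ℤ) ∣ y)) :
    ∃ b c d, T a b c d ∧ b ≡ A * x ^ 2 + B * x * y + C * y ^ 2 - a [ZMOD m] := by
  obtain ⟨r, hr⟩ := exists_forall_prime_cast_eq hm
    (fun p => if (y : ZMod p) = 0 then (1 : ZMod p) else 0)
  obtain ⟨s', hs'⟩ : ∃ s' : ℤ, (y - r * x) * s' ≡ 1 [ZMOD m] := by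
    refine exists_mul_modEq_one fun p hp hpm hdvd => ?_
    have hxy' := hxy p hp hpm
    rw [← ZMod.intCast_zmod_eq_zero_iff_dvd _ p, ← ZMod.intCast_zmod_eq_zero_iff_dvd _ p] at hxy'
    rw [← ZMod.intCast_zmod_eq_zero_iff_dvd _ p] at hdvd
    have hrp := hr p hp hpm
    push_cast at hdvd
    split_ifs at hrp with hy
    · rw [hrp, hy] at hdvd
      exact hxy' ⟨by simpa using hdvd, hy⟩
    · rw [hrp] at hdvd
      exact hy (by simpa using hdvd)
  obtain ⟨n₁, h₁⟩ := exists_two_mul_nat_modEq hodd r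
  obtain ⟨n₂, h₂⟩ := exists_two_mul_nat_modEq hodd ((x - 1) * s')
  obtain ⟨n₃, h₃⟩ := exists_two_mul_nat_modEq hodd (y - r * x)
  have key := hT.lower (hT.upper (hT.lower h n₁ rfl) n₂ rfl) n₃ rfl
  refine ⟨_, _, _, key, ?_⟩
  simp only [← ZMod.intCast_eq_intCast_iff] at h₁ h₂ h₃ hs' ⊢
  push_cast at h₁ h₂ h₃ hs' ⊢
  rw [h₁, h₂, h₃]
  generalize (x : ZMod m) = X at *
  generalize (y : ZMod m) = Y at *
  generalize (r : ZMod m) = R at *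
  generalize (s' : ZMod m) = U at *
  have e : (X - 1) * U * (Y - R * X) = X - 1 := by linear_combination (X - 1) * hs'
  generalize hu : (X - 1) * U = t at e ⊢
  have hX : X = 1 + t * (Y - R * X) := by linear_combination -e
  generalize hσ : Y - R * X = σ at hX ⊢
  have hY : Y = σ + R * X := by linear_combination hσ
  rw [hY, hX]
  ring

/-- If `N` is prime to the odd number `m` and `N'` agrees with `N` modulo every prime divisor of
`m`, then `N` is a square multiple of `N'` modulo `m`. -/
theorem exists_sq_mul_modEq {m : ℕ} (hodd : Odd m) {N N' : ℤ}
    (hN : ∀ p : ℕ, p.Prime → p ∣ m → ¬ (p : ℤ) ∣ N)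
    (hNN' : ∀ p : ℕ, p.Prime → p ∣ m → (N' : ZMod p) = N) :
    ∃ z : ℤ, z ^ 2 * N' ≡ N [ZMOD m] ∧ ∃ z' : ℤ, z * z' ≡ 1 [ZMOD m] := by
  obtain ⟨M, hM⟩ : ∃ M : ℤ, N' * M ≡ 1 [ZMOD m] := by
    refine exists_mul_modEq_one fun p hp hpm hdvd => hN p hp hpm ?_
    rw [← ZMod.intCast_zmod_eq_zero_iff_dvd _ p] at hdvd ⊢
    rw [← hNN' p hp hpm, hdvd]
  have hq : ∀ p : ℕ, p.Prime → p ∣ m → (p : ℤ) ∣ N * M - 1 := by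
    intro p hp hpm
    have h1 : N' * M ≡ 1 [ZMOD p] := hM.of_dvd (Int.natCast_dvd_natCast.2 hpm)
    rw [← ZMod.intCast_eq_intCast_iff] at h1
    rw [← ZMod.intCast_zmod_eq_zero_iff_dvd _ p]
    push_cast at h1 ⊢
    rw [← hNN' p hp hpm, h1, sub_self]
  have hpow : (m : ℤ) ∣ (N * M) ^ m - 1 := by
    rw [Int.natCast_dvd, Nat.dvd_iff_prime_pow_dvd_dvd]
    intro p e hp hpe
    rw [← Int.natCast_dvd]
    rcases Nat.eq_zero_or_pos e with rfl | he
    · simp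
    have h1 := dvd_sub_pow_of_dvd_sub (hq p hp ((dvd_pow_self p he.ne').trans hpe)) e
    obtain ⟨j, rfl⟩ := hpe
    rw [pow_mul]
    rw [one_pow] at h1
    push_cast
    exact ((pow_dvd_pow _ e.le_succ).trans h1).trans (sub_one_dvd_pow_sub_one _ _)
  have hpow' : ((N : ZMod m) * M) ^ m = 1 := by
    have := (ZMod.intCast_zmod_eq_zero_iff_dvd _ m).2 hpow
    push_cast at this
    exact sub_eq_zero.1 this
  obtain ⟨j, hj⟩ := hodd
  simp only [← ZMod.intCast_eq_intCast_iff] at hM ⊢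
  push_cast at hM ⊢
  refine ⟨(N * M) ^ (j + 1), ?_, (N * M) ^ j, ?_⟩
  · push_cast
    have e : (((N : ZMod m) * M) ^ (j + 1)) ^ 2 = (N * M) ^ m * (N * M) := by
      rw [← pow_mul, ← pow_succ, hj]; congr 1; ring
    rw [e, hpow']
    linear_combination (N : ZMod m) * hM
  · push_cast
    rw [← pow_add, ← hpow']
    congr 1
    omega

section Local

variable {p : ℕ} [Fact p.Prime] {a A B C : ZMod p}

theorem exists_form_eq (h2 : (2 : ZMod p) ≠ 0) (hdisc : 4 * A * C - B ^ 2 = 4 * a ^ 2)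
    (ha : a ≠ 0) (N : ZMod p) : ∃ x y, A * x ^ 2 + B * x * y + C * y ^ 2 = N := by
  by_cases hA : A = 0
  · subst hA
    have hB : B ≠ 0 := by
      rintro rfl
      have h : (2 * a) ^ 2 = 0 := by linear_combination -hdisc
      exact mul_ne_zero h2 ha (pow_eq_zero_iff two_ne_zero |>.1 h)
    refine ⟨(N - C) / B, 1, ?_⟩
    field_simp
    ring
  · obtain ⟨X, Y, h⟩ := ZMod.sq_add_sq p (4 * A * N)
    obtain ⟨y, hy⟩ : ∃ y, 2 * a * y = Y := ⟨Y / (2 * a), by field_simp⟩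
    obtain ⟨x, hx⟩ : ∃ x, 2 * A * x + B * y = X := ⟨(X - B * y) / (2 * A), by field_simp; ring⟩
    refine ⟨x, y, ?_⟩
    have h4 : 2 * (2 * A) ≠ 0 := mul_ne_zero h2 (mul_ne_zero h2 hA)
    apply mul_left_cancel₀ h4
    subst hy hx
    linear_combination h + y ^ 2 * hdisc

theorem exists_form_ne (h5 : 5 ≤ p) (hdisc : 4 * A * C - B ^ 2 = 4 * a ^ 2)
    (hne : ¬ (a = 0 ∧ A = 0 ∧ C = 0)) (k : ZMod p) :
    ∃ x y, A * x ^ 2 + B * x * y + C * y ^ 2 ≠ 0 ∧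
      A * x ^ 2 + B * x * y + C * y ^ 2 - a ≠ 0 ∧
      A * x ^ 2 + B * x * y + C * y ^ 2 - a + k ≠ 0 := by
  have hsmall : ∀ n : ℕ, 0 < n → n < p → (n : ZMod p) ≠ 0 := fun n h0 hn h =>
    absurd (Nat.le_of_dvd h0 ((ZMod.natCast_eq_zero_iff _ _).1 h)) (by omega)
  have h2 : (2 : ZMod p) ≠ 0 := by exact_mod_cast hsmall 2 (by omega) (by omega)
  have h3 : (3 : ZMod p) ≠ 0 := by exact_mod_cast hsmall 3 (by omega) (by omega)
  by_cases ha : a = 0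
  · subst ha
    have scale : ∀ D : ZMod p, D ≠ 0 → ∃ z : ZMod p, D * z ^ 2 ≠ 0 ∧ D * z ^ 2 + k ≠ 0 := by
      intro D hD
      by_cases h : D + k = 0
      · refine ⟨2, mul_ne_zero hD (pow_ne_zero 2 h2), fun h' => mul_ne_zero hD h3 ?_⟩
        linear_combination h' - h
      · exact ⟨1, by simpa using hD, by simpa using h⟩
    by_cases hA : A = 0
    · obtain ⟨z, h, h'⟩ := scale C fun hC => hne ⟨rfl, hA, hC⟩
      exact ⟨0, z, by simpa using h, by simpa using h, by simpa using h'⟩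
    · obtain ⟨z, h, h'⟩ := scale A hA
      exact ⟨z, 0, by simpa using h, by simpa using h, by simpa using h'⟩
  · obtain ⟨u, hu⟩ : ∃ u : ZMod p, u ∉ ({0, a, a - k} : Finset (ZMod p)) := by
      by_contra! hall
      have h1 := Finset.card_le_card (fun u _ => hall u : Finset.univ ⊆ _)
      rw [Finset.card_univ, ZMod.card] at h1
      have := h1.trans Finset.card_le_three
      omega
    simp only [Finset.mem_insert, Finset.mem_singleton, not_or] at hu
    obtain ⟨x, y, hxy⟩ := exists_form_eq h2 hdisc ha u
    refine ⟨x, y, ?_⟩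
    rw [hxy]
    exact ⟨hu.1, sub_ne_zero.2 hu.2.1, fun h => hu.2.2 (by linear_combination h)⟩

end Local

/-- Simultaneous solution in two variables modulo the prime divisors of `m`. -/
theorem exists_forall_prime_pair {m : ℕ} (hm : 0 < m) (P : ∀ p : ℕ, ZMod p → ZMod p → Prop)
    (h : ∀ p : ℕ, p.Prime → p ∣ m → ∃ x y, P p x y) :
    ∃ x y : ℤ, ∀ p : ℕ, p.Prime → p ∣ m → P p x y := by
  choose! f g hfg using h
  obtain ⟨x, hx⟩ := exists_forall_prime_cast_eq hm f
  obtain ⟨y, hy⟩ := exists_forall_prime_cast_eq hm g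
  refine ⟨x, y, fun p hp hpm => ?_⟩
  rw [hx p hp hpm, hy p hp hpm]
  exact hfg p hp hpm

/-- The Descartes equation is invariant under flips. -/
theorem FlipClosed.and_descartes {T : ℤ → ℤ → ℤ → ℤ → Prop} (hT : FlipClosed T) :
    FlipClosed fun a b c d =>
      T a b c d ∧ 2 * (a ^ 2 + b ^ 2 + c ^ 2 + d ^ 2) = (a + b + c + d) ^ 2 := by
  rintro a b c d ⟨h, hD⟩
  obtain ⟨h0, h1, h2, h3⟩ := hT a b c d h
  exact ⟨⟨h0, by linear_combination hD⟩, ⟨h1, by linear_combination hD⟩,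
    ⟨h2, by linear_combination hD⟩, ⟨h3, by linear_combination hD⟩⟩

theorem FlipClosed.exists_modEq {T : ℤ → ℤ → ℤ → ℤ → Prop} (hT : FlipClosed T)
    {a b c d : ℤ} (h : T a b c d)
    (hD : 2 * (a ^ 2 + b ^ 2 + c ^ 2 + d ^ 2) = (a + b + c + d) ^ 2)
    {m : ℕ} (hm : 0 < m) (hodd : Odd m) {k : ℤ}
    (ha : ∀ p : ℕ, p.Prime → p ∣ m → (a : ZMod p) ≠ 0)
    (hak : ∀ p : ℕ, p.Prime → p ∣ m → ((a + k : ℤ) : ZMod p) ≠ 0) :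
    ∃ b' c' d', T a b' c' d' ∧ b' ≡ k [ZMOD m] := by
  obtain ⟨A, rfl⟩ : ∃ A, b = A - a := ⟨b + a, by ring⟩
  obtain ⟨C, rfl⟩ : ∃ C, c = C - a := ⟨c + a, by ring⟩
  obtain ⟨B, rfl⟩ : ∃ B, d = A + B + C - a := ⟨d + a - A - C, by ring⟩
  have hdisc : 4 * A * C - B ^ 2 = 4 * a ^ 2 := by linear_combination -hD
  obtain ⟨x, y, hxy⟩ := exists_forall_prime_pair hm
    (fun p x y => A * x ^ 2 + B * x * y + C * y ^ 2 = ((a + k : ℤ) : ZMod p)) (by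
      intro p hp hpm
      have : Fact p.Prime := ⟨hp⟩
      refine exists_form_eq (fun h2 => ?_) (by exact_mod_cast congrArg (Int.cast (R := ZMod p)) hdisc)
        (ha p hp hpm) _
      have h2' : p ∣ 2 := (ZMod.natCast_eq_zero_iff 2 p).1 (by exact_mod_cast h2)
      rw [Nat.prime_dvd_prime_iff_eq hp Nat.prime_two] at h2'
      exact (Nat.not_even_iff_odd.2 hodd) (even_iff_two_dvd.2 (h2' ▸ hpm)))
  obtain ⟨z, hz, z', hz'⟩ := exists_sq_mul_modEq hodd (N := a + k)
    (N' := A * x ^ 2 + B * x * y + C * y ^ 2)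
    (fun p hp hpm hdvd => hak p hp hpm ((ZMod.intCast_zmod_eq_zero_iff_dvd _ p).2 hdvd))
    (fun p hp hpm => by have := hxy p hp hpm; push_cast at this ⊢; exact this)
  obtain ⟨b', c', d', h', hb'⟩ := hT.exists_modEq_form h hm hodd (x := z * x) (y := z * y) (by
    rintro p hp hpm ⟨hx, hy⟩
    have h0 := (ZMod.intCast_eq_intCast_iff _ _ _).2
      (hz.of_dvd (Int.natCast_dvd_natCast.2 hpm))
    rw [← ZMod.intCast_zmod_eq_zero_iff_dvd _ p] at hx hy
    apply hak p hp hpm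
    rw [← h0]
    push_cast at hx hy ⊢
    linear_combination (A * z * x + B * z * y : ZMod p) * hx + (C * z * y : ZMod p) * hy)
  refine ⟨b', c', d', h', hb'.trans ?_⟩
  convert hz.sub_right a using 1 <;> ring

theorem FlipClosed.exists_coprime {T : ℤ → ℤ → ℤ → ℤ → Prop} (hT : FlipClosed T)
    {a b c d : ℤ} (h : T a b c d)
    (hD : 2 * (a ^ 2 + b ^ 2 + c ^ 2 + d ^ 2) = (a + b + c + d) ^ 2)
    {m : ℕ} (hm : 0 < m) (hodd : Odd m) (h5 : ∀ p : ℕ, p.Prime → p ∣ m → 5 ≤ p)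
    (hprim : ∀ p : ℕ, p.Prime →
      ¬ ((a : ZMod p) = 0 ∧ (b : ZMod p) = 0 ∧ (c : ZMod p) = 0 ∧ (d : ZMod p) = 0)) (k : ℤ) :
    ∃ b' c' d', T a b' c' d' ∧ ∀ p : ℕ, p.Prime → p ∣ m →
      (b' : ZMod p) ≠ 0 ∧ ((b' + k : ℤ) : ZMod p) ≠ 0 := by
  obtain ⟨A, rfl⟩ : ∃ A, b = A - a := ⟨b + a, by ring⟩
  obtain ⟨C, rfl⟩ : ∃ C, c = C - a := ⟨c + a, by ring⟩
  obtain ⟨B, rfl⟩ : ∃ B, d = A + B + C - a := ⟨d + a - A - C, by ring⟩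
  have hdisc : 4 * A * C - B ^ 2 = 4 * a ^ 2 := by linear_combination -hD
  obtain ⟨x, y, hxy⟩ := exists_forall_prime_pair hm
    (fun p x y => A * x ^ 2 + B * x * y + C * y ^ 2 ≠ (0 : ZMod p) ∧
      A * x ^ 2 + B * x * y + C * y ^ 2 - a ≠ (0 : ZMod p) ∧
      A * x ^ 2 + B * x * y + C * y ^ 2 - a + k ≠ (0 : ZMod p)) (by
      intro p hp hpm
      have : Fact p.Prime := ⟨hp⟩
      have hdisc' : (4 * A * C - B ^ 2 : ZMod p) = 4 * a ^ 2 := by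
        exact_mod_cast congrArg (Int.cast (R := ZMod p)) hdisc
      refine exists_form_ne (h5 p hp hpm) hdisc' ?_ _
      rintro ⟨ha, hA, hC⟩
      have hB : (B : ZMod p) = 0 := by
        rw [ha, hA] at hdisc'
        exact (pow_eq_zero_iff two_ne_zero).1 (by linear_combination -hdisc')
      exact hprim p hp (by push_cast; simp [ha, hA, hB, hC]))
  obtain ⟨b', c', d', h', hb'⟩ := hT.exists_modEq_form h hm hodd (x := x) (y := y) (by
    rintro p hp hpm ⟨hx, hy⟩
    rw [← ZMod.intCast_zmod_eq_zero_iff_dvd _ p] at hx hy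
    apply (hxy p hp hpm).1
    rw [hx, hy]
    ring)
  refine ⟨b', c', d', h', fun p hp hpm => ?_⟩
  have h0 := (ZMod.intCast_eq_intCast_iff _ _ _).2
    (hb'.of_dvd (Int.natCast_dvd_natCast.2 hpm))
  push_cast at h0 ⊢
  rw [h0]
  exact (hxy p hp hpm).2

theorem S_mulVec (i : Fin 4) (w : Fin 4 → ℤ) :
    (S i).mulVec w = Function.update w i (2 * (w 0 + w 1 + w 2 + w 3) - 3 * w i) := by
  ext j
  fin_cases i <;> fin_cases j <;>
    simp [S, Matrix.mulVec, dotProduct, Fin.sum_univ_four, Function.update] <;> ring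

theorem flipClosed_orbit (v : Fin 4 → ℤ) :
    FlipClosed fun a b c d => ∃ l : List (Fin 4), (l.map S).prod.mulVec v = ![a, b, c, d] := by
  rintro a b c d ⟨l, hl⟩
  have step (i : Fin 4) : (((i :: l).map S).prod).mulVec v = (S i).mulVec ![a, b, c, d] := by
    rw [List.map_cons, List.prod_cons, ← Matrix.mulVec_mulVec, hl]
  refine ⟨⟨0 :: l, ?_⟩, ⟨1 :: l, ?_⟩, ⟨2 :: l, ?_⟩, ⟨3 :: l, ?_⟩⟩ <;>
  · rw [step, S_mulVec]
    ext j
    fin_cases j <;> (simp [Function.update]; try ring)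

/-- **All residue classes mod `m` occur for `gcd(m,30) = 1`.**
Let `v` be a primitive integer Descartes quadruple with positive entry-sum and
let `m` be a positive integer coprime to 30.  Then every residue class `k`
modulo `m` occurs as an entry of some vector `M·v` with `M` a finite product of
the generators `S₁, S₂, S₃, S₄`; that is, every residue class mod `m` occurs as
a curvature in the Apollonian packing generated by `v`. -/
theorem all_residues_occur (v : Fin 4 → ℤ)
    (hD : 2 * (v 0 ^ 2 + v 1 ^ 2 + v 2 ^ 2 + v 3 ^ 2) = (v 0 + v 1 + v 2 + v 3) ^ 2)
    (hprim : Finset.univ.gcd v = 1)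
    (hsum : 0 < v 0 + v 1 + v 2 + v 3)
    (m : ℕ) (hm : 0 < m) (hm30 : Nat.gcd m 30 = 1) (k : ℤ) :
    ∃ (l : List (Fin 4)) (i : Fin 4),
      ((l.map S).prod.mulVec v) i ≡ k [ZMOD (m : ℤ)] := by
  have hdvd30 : ∀ p : ℕ, p ∣ m → p ∣ 30 → p = 1 := fun p h h' =>
    Nat.dvd_one.1 (hm30 ▸ Nat.dvd_gcd h h')
  have hodd : Odd m := by
    rw [← Nat.not_even_iff_odd, even_iff_two_dvd]
    exact fun h => absurd (hdvd30 2 h (by norm_num)) (by norm_num)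
  have h5 : ∀ p : ℕ, p.Prime → p ∣ m → 5 ≤ p := by
    intro p hp hpm
    by_contra! hlt
    have h30 := hdvd30 p hpm
    interval_cases p <;> revert hp h30 <;> norm_num
  have hprim' : ∀ p : ℕ, p.Prime → ¬ ((v 0 : ZMod p) = 0 ∧ (v 1 : ZMod p) = 0 ∧
      (v 2 : ZMod p) = 0 ∧ (v 3 : ZMod p) = 0) := by
    rintro p hp ⟨h0, h1, h2, h3⟩
    have hdvd : (p : ℤ) ∣ Finset.univ.gcd v := by
      refine Finset.dvd_gcd fun i _ => (ZMod.intCast_zmod_eq_zero_iff_dvd _ p).1 ?_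
      fin_cases i <;> assumption
    rw [hprim] at hdvd
    exact hp.one_lt.ne' (by exact_mod_cast Int.eq_one_of_dvd_one (by positivity) hdvd)
  have hT := (flipClosed_orbit v).and_descartes
  have hv : ∃ l : List (Fin 4), (l.map S).prod.mulVec v = ![v 0, v 1, v 2, v 3] :=
    ⟨[], by ext j; fin_cases j <;> simp⟩
  obtain ⟨b, c, d, ⟨hb, hbD⟩, hcop⟩ :=
    hT.exists_coprime ⟨hv, hD⟩ hD hm hodd h5 hprim' k
  obtain ⟨a', c', d', ⟨l, hl⟩, hk⟩ := (flipClosed_orbit v).swap.exists_modEq hb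
    (by linear_combination hbD) hm hodd (fun p hp hpm => (hcop p hp hpm).1)
    (fun p hp hpm => (hcop p hp hpm).2)
  exact ⟨l, 0, by rw [hl]; exact hk⟩
end

section
/- For n = 4m + i with 0 ≤ i ≤ 3, let T_n := T_i·(S₄S₃S₂S₁)^m, where T₀ = I, T₁ = S₁, T₂ = S₂S₁, T₃ = S₃S₂S₁. Let v = (a,b,c,d)ᵀ be an integer root quadruple with a ≤ b ≤ c ≤ d, a < 0, and a+b+c+d > 0. Then for every reduced word W of length n in the generators S₁, S₂, S₃, S₄ (consecutive factors distinct), one has ‖W·v‖_∞ ≤ ‖T_n·v‖_∞, where ‖w‖_∞ is the maximum of the absolute values of the entries of w. -/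
/-- The prefix words `T₀ = I`, `T₁ = S₁`, `T₂ = S₂S₁`, `T₃ = S₃S₂S₁`. -/
def Tpre : ℕ → Matrix (Fin 4) (Fin 4) ℤ
  | 0 => 1
  | 1 => S 0
  | 2 => S 1 * S 0
  | 3 => S 2 * S 1 * S 0
  | _ => 1

/-- The extremal word `T_n = T_{n mod 4} (S₄S₃S₂S₁)^(n/4)`. -/
def Tword (n : ℕ) : Matrix (Fin 4) (Fin 4) ℤ :=
  Tpre (n % 4) * (S 3 * S 2 * S 1 * S 0) ^ (n / 4)

/-- The order of coordinates in which `k` comes last and the others keep their order. -/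
noncomputable def lastPerm (k : Fin 4) : Equiv.Perm (Fin 4) :=
  Equiv.ofBijective ![k.succAbove 0, k.succAbove 1, k.succAbove 2, k] (by decide +revert)

/-- Apply `S k` and move the changed entry to the last position. -/
noncomputable def step (k : Fin 4) (x : Fin 4 → ℤ) : Fin 4 → ℤ :=
  (S k).mulVec x ∘ lastPerm k

/-- A Descartes quadruple with nonnegative pairwise sums. -/
def PairNonneg (x : Fin 4 → ℤ) : Prop :=
  2 * (x 0 ^ 2 + x 1 ^ 2 + x 2 ^ 2 + x 3 ^ 2) = (x 0 + x 1 + x 2 + x 3) ^ 2 ∧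
    0 ≤ x 0 + x 1 ∧ 0 ≤ x 0 + x 2 ∧ 0 ≤ x 0 + x 3 ∧
    0 ≤ x 1 + x 2 ∧ 0 ≤ x 1 + x 3 ∧ 0 ≤ x 2 + x 3

lemma mulVec_S (k : Fin 4) (x : Fin 4 → ℤ) :
    (S k).mulVec x = Function.update x k (2 * ∑ j, x j - 3 * x k) := by
  funext m
  fin_cases k <;> fin_cases m <;>
    simp [S, Matrix.mulVec, dotProduct, Fin.sum_univ_four] <;> ring

lemma mulVec_S_comp (σ : Equiv.Perm (Fin 4)) (k : Fin 4) (x : Fin 4 → ℤ) :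
    (S (σ k)).mulVec x ∘ σ = (S k).mulVec (x ∘ σ) := by
  rw [mulVec_S, mulVec_S, Function.update_comp_eq_of_injective _ σ.injective]
  simp [Equiv.sum_comp σ x]

lemma lastPerm_three (k : Fin 4) : lastPerm k 3 = k := rfl

lemma step_zero (x : Fin 4 → ℤ) :
    step 0 x = ![x 1, x 2, x 3, 2 * (x 1 + x 2 + x 3) - x 0] := by
  funext m
  fin_cases m <;>
    simp [step, mulVec_S, lastPerm, Fin.sum_univ_four, Fin.succAbove]
  ring

lemma step_one (x : Fin 4 → ℤ) :
    step 1 x = ![x 0, x 2, x 3, 2 * (x 0 + x 2 + x 3) - x 1] := by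
  funext m
  fin_cases m <;>
    simp [step, mulVec_S, lastPerm, Fin.sum_univ_four, Fin.succAbove]
  ring

lemma step_two (x : Fin 4 → ℤ) :
    step 2 x = ![x 0, x 1, x 3, 2 * (x 0 + x 1 + x 3) - x 2] := by
  funext m
  fin_cases m <;>
    simp [step, mulVec_S, lastPerm, Fin.sum_univ_four, Fin.succAbove]
  ring

lemma step_three (x : Fin 4 → ℤ) :
    step 3 x = ![x 0, x 1, x 2, 2 * (x 0 + x 1 + x 2) - x 3] := by
  funext m
  fin_cases m <;>
    simp [step, mulVec_S, lastPerm, Fin.sum_univ_four, Fin.succAbove]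
  ring

/-- If `2 * x k` is at most the sum of all entries, then `step k` yields a quadruple whose last
entry is at least the sum of the others. -/
lemma PairNonneg.step {x : Fin 4 → ℤ} (h : PairNonneg x) (k : Fin 4)
    (hk : 2 * x k ≤ ∑ j, x j) :
    PairNonneg (step k x) ∧ step k x 0 + step k x 1 + step k x 2 ≤ step k x 3 := by
  obtain ⟨hD, h01, h02, h03, h12, h13, h23⟩ := h
  rw [Fin.sum_univ_four] at hk
  fin_cases k <;> simp only [step_zero, step_one, step_two, step_three, PairNonneg,
      Fin.zero_eta, Fin.mk_one, Fin.reduceFinMk, Matrix.cons_val] at hk ⊢ <;>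
    refine ⟨⟨by linear_combination hD, ?_, ?_, ?_, ?_, ?_, ?_⟩, ?_⟩ <;> linarith

lemma two_mul_le_sum {x : Fin 4 → ℤ} (h : PairNonneg x) (h3 : x 0 + x 1 + x 2 ≤ x 3)
    {k : Fin 4} (hk : k ≠ 3) : 2 * x k ≤ ∑ j, x j := by
  obtain ⟨-, h01, h02, h03, h12, h13, h23⟩ := h
  rw [Fin.sum_univ_four]
  fin_cases k <;> simp at hk ⊢ <;> linarith

/-- The larger root of the Descartes equation is monotone in the other three entries. -/
lemma last_le_last {u x : Fin 4 → ℤ} (hu : PairNonneg u) (hx : PairNonneg x)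
    (hx3 : x 0 + x 1 + x 2 ≤ x 3) (h0 : u 0 ≤ x 0) (h1 : u 1 ≤ x 1) (h2 : u 2 ≤ x 2) :
    u 3 ≤ x 3 := by
  obtain ⟨hDu, u01, u02, -, u12, -, -⟩ := hu
  obtain ⟨hDx, x01, x02, -, x12, -, -⟩ := hx
  have key : (u 3 - (u 0 + u 1 + u 2)) ^ 2 ≤ (x 3 - (x 0 + x 1 + x 2)) ^ 2 := by
    have e0 := mul_nonneg (sub_nonneg.2 h0) u12
    have e1 : 0 ≤ (x 1 - u 1) * (x 0 + u 2) := mul_nonneg (sub_nonneg.2 h1) (by linarith)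
    have e2 := mul_nonneg (sub_nonneg.2 h2) x01
    linarith
  have := abs_le_of_sq_le_sq' key (by linarith)
  linarith [this.2]

lemma step_le_step_zero {u x : Fin 4 → ℤ} (hu : PairNonneg u) (hx : PairNonneg x)
    (hmono : Monotone x) (hux : u ≤ x) (k : Fin 4) (huk : 2 * u k ≤ ∑ j, u j)
    (hxk : 2 * x 0 ≤ ∑ j, x j) : step k u ≤ step 0 x := by
  have hu' := hu.step k huk
  have hx' := hx.step 0 hxk
  have x01 : x 0 ≤ x 1 := hmono (by decide)
  have x12 : x 1 ≤ x 2 := hmono (by decide)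
  have x23 : x 2 ≤ x 3 := hmono (by decide)
  have a0 := hux 0
  have a1 := hux 1
  have a2 := hux 2
  have a3 := hux 3
  have b : step k u 0 ≤ step 0 x 0 ∧ step k u 1 ≤ step 0 x 1 ∧ step k u 2 ≤ step 0 x 2 := by
    fin_cases k <;> simp [step_zero, step_one, step_two, step_three] <;>
      refine ⟨?_, ?_, ?_⟩ <;> linarith
  have b3 := last_le_last hu'.1 hx'.1 hx'.2 b.1 b.2.1 b.2.2
  intro j
  fin_cases j
  exacts [b.1, b.2.1, b.2.2, b3]

lemma monotone_step_zero {x : Fin 4 → ℤ} (hx : PairNonneg x) (hmono : Monotone x)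
    (hxk : 2 * x 0 ≤ ∑ j, x j) : Monotone (step 0 x) := by
  have x12 : x 1 ≤ x 2 := hmono (by decide)
  have x23 : x 2 ≤ x 3 := hmono (by decide)
  obtain ⟨-, h01, h02, h03, h12, h13, h23⟩ := hx
  rw [Fin.sum_univ_four] at hxk
  rw [Fin.monotone_iff_le_succ]
  intro i
  fin_cases i <;> simp [step_zero] <;> linarith

lemma Tword_succ (n : ℕ) : Tword (n + 1) = S (Fin.ofNat 4 n) * Tword n := by
  obtain ⟨m, i, hi, rfl⟩ : ∃ m i, i < 4 ∧ n = 4 * m + i :=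
    ⟨n / 4, n % 4, Nat.mod_lt _ (by norm_num), by omega⟩
  have hc : Fin.ofNat 4 (4 * m + i) = Fin.ofNat 4 i := by
    simp [Fin.ext_iff]
  rw [hc]
  unfold Tword
  interval_cases i
  · rw [show (4 * m + 0 + 1) % 4 = 1 by omega, show (4 * m + 0 + 1) / 4 = m by omega,
      show (4 * m + 0) % 4 = 0 by omega, show (4 * m + 0) / 4 = m by omega]
    simp [Tpre]
  · rw [show (4 * m + 1 + 1) % 4 = 2 by omega, show (4 * m + 1 + 1) / 4 = m by omega,
      show (4 * m + 1) % 4 = 1 by omega, show (4 * m + 1) / 4 = m by omega]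
    simp only [Tpre, mul_assoc]
    rfl
  · rw [show (4 * m + 2 + 1) % 4 = 3 by omega, show (4 * m + 2 + 1) / 4 = m by omega,
      show (4 * m + 2) % 4 = 2 by omega, show (4 * m + 2) / 4 = m by omega]
    simp [Tpre, mul_assoc]
  · rw [show (4 * m + 3 + 1) % 4 = 0 by omega, show (4 * m + 3 + 1) / 4 = m + 1 by omega,
      show (4 * m + 3) % 4 = 3 by omega, show (4 * m + 3) / 4 = m by omega]
    simp [Tpre, pow_succ', mul_assoc]

lemma Tword_mulVec_comp (v : Fin 4 → ℤ) (n : ℕ) :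
    (Tword n).mulVec v ∘ Equiv.addLeft (Fin.ofNat 4 n) = (step 0)^[n] v := by
  induction n with
  | zero => funext j; simp [Tword, Tpre]
  | succ n ih =>
    rw [Function.iterate_succ_apply', ← ih, step, ← mulVec_S_comp, Tword_succ,
      ← Matrix.mulVec_mulVec]
    funext j
    have hj : Fin.ofNat 4 (n + 1) + j = Fin.ofNat 4 n + lastPerm 0 j := by
      have : lastPerm 0 j = 1 + j := by fin_cases j <;> rfl
      rw [this, ← add_assoc]
      congr 1
      simp [Fin.ext_iff, Fin.val_add]
    simp only [Function.comp_apply, Equiv.coe_addLeft, hj, add_zero]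

/-- After a nonempty reduced word, the quadruple is, up to a reordering that puts the entry
changed last in the last position, dominated entrywise by the one obtained by always changing
the smallest entry. -/
lemma exists_perm_le_iterate {v : Fin 4 → ℤ} (hv : PairNonneg v) (hmono : Monotone v)
    (hk : ∀ k, 2 * v k ≤ ∑ j, v j) (t : List (Fin 4)) :
    ∀ i : Fin 4, (i :: t).IsChain (· ≠ ·) →
    ∃ σ : Equiv.Perm (Fin 4), σ 3 = i ∧
      let u := (((i :: t).map S).prod.mulVec v) ∘ σ
      let x := (step 0)^[t.length + 1] v
      PairNonneg u ∧ u 0 + u 1 + u 2 ≤ u 3 ∧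
        PairNonneg x ∧ x 0 + x 1 + x 2 ≤ x 3 ∧ Monotone x ∧ u ≤ x := by
  induction t with
  | nil =>
    intro i _
    refine ⟨lastPerm i, lastPerm_three i, ?_⟩
    have e : (([i].map S).prod.mulVec v) ∘ lastPerm i = step i v := by simp [step]
    simp only [e, List.length_nil, zero_add, Function.iterate_one]
    exact ⟨(hv.step i (hk i)).1, (hv.step i (hk i)).2, (hv.step 0 (hk 0)).1,
      (hv.step 0 (hk 0)).2, monotone_step_zero hv hmono (hk 0),
      step_le_step_zero hv hv hmono le_rfl i (hk i) (hk 0)⟩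
  | cons j t ih =>
    intro i hc
    rw [List.isChain_cons_cons] at hc
    obtain ⟨σ, hσ, hu, hu3, hx, hx3, hm, hux⟩ := ih j hc.2
    set w := ((j :: t).map S).prod.mulVec v with hw
    set x := (step 0)^[t.length + 1] v
    set k := σ.symm i with hkdef
    have hik : σ k = i := by simp [hkdef]
    have hk3 : k ≠ 3 := fun h => hc.1 (by rw [← hik, h, hσ])
    have hku := two_mul_le_sum hu hu3 hk3
    have hkx := two_mul_le_sum hx hx3 (k := 0) (by decide)
    refine ⟨(lastPerm k).trans σ, by simp [lastPerm_three, hik], ?_⟩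
    have e : (((i :: j :: t).map S).prod.mulVec v) ∘ (lastPerm k).trans σ = step k (w ∘ σ) := by
      rw [step, ← mulVec_S_comp, hik, List.map_cons, List.prod_cons, ← Matrix.mulVec_mulVec]
      rfl
    have e' : (step 0)^[(j :: t).length + 1] v = step 0 x := Function.iterate_succ_apply' _ _ _
    simp only [e, e']
    exact ⟨(hu.step k hku).1, (hu.step k hku).2, (hx.step 0 hkx).1, (hx.step 0 hkx).2,
      monotone_step_zero hx hm hkx, step_le_step_zero hu hx hm hux k hku hkx⟩

/-- **The word `T_n` maximizes the sup norm.**  Let `v = (a,b,c,d)` be an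
integer root quadruple with `a ≤ b ≤ c ≤ d`, `a < 0` and `a+b+c+d > 0`.  Then
for every reduced word `W` of length `n` in the generators (consecutive
factors distinct), `‖W·v‖_∞ ≤ ‖T_n·v‖_∞`. -/
theorem Tword_maximizes (v : Fin 4 → ℤ)
    (hD : 2 * (v 0 ^ 2 + v 1 ^ 2 + v 2 ^ 2 + v 3 ^ 2) = (v 0 + v 1 + v 2 + v 3) ^ 2)
    (ha : v 0 < 0) (hab : v 0 ≤ v 1) (hbc : v 1 ≤ v 2) (hcd : v 2 ≤ v 3)
    (hsum : 0 < v 0 + v 1 + v 2 + v 3) (hroot : v 3 ≤ v 0 + v 1 + v 2)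
    (n : ℕ) (l : List (Fin 4)) (hlen : l.length = n) (hred : l.Chain' (· ≠ ·)) :
    (Finset.univ.sup' Finset.univ_nonempty fun i => |((l.map S).prod.mulVec v) i|) ≤
      Finset.univ.sup' Finset.univ_nonempty fun i => |((Tword n).mulVec v) i| := by
  have hv : PairNonneg v := by
    refine ⟨hD, ?_, ?_, ?_, ?_, ?_, ?_⟩ <;> linarith
  have hmono : Monotone v := by
    rw [Fin.monotone_iff_le_succ]
    intro i
    fin_cases i
    exacts [hab, hbc, hcd]
  have hk : ∀ k, 2 * v k ≤ ∑ j, v j := by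
    intro k
    rw [Fin.sum_univ_four]
    fin_cases k <;> simp <;> linarith
  subst hlen
  cases l with
  | nil => simp [Tword, Tpre]
  | cons i t =>
    obtain ⟨σ, -, ⟨-, h01, h02, h03, h12, h13, h23⟩, hu3, -, -, -, hux⟩ :=
      exists_perm_le_iterate hv hmono hk t i hred
    have h3 := hux 3
    rw [← Tword_mulVec_comp] at h3
    refine Finset.sup'_le _ _ fun m _ => ?_
    refine le_trans ?_ (Finset.le_sup' _ (Finset.mem_univ
      (Equiv.addLeft (Fin.ofNat 4 (t.length + 1)) 3)))
    refine le_trans ?_ (h3.trans (le_abs_self _))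
    obtain ⟨p, rfl⟩ := σ.surjective m
    rw [abs_le]
    simp only [Function.comp_apply] at h01 h02 h03 h12 h13 h23 hu3 ⊢
    fin_cases p <;> simp only [Fin.zero_eta, Fin.mk_one, Fin.reduceFinMk] <;>
      constructor <;> linarith
end
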